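/- Let p ∈ (1,∞] and let X denote either W^{1,p} or C^{0,1−1/p}. Suppose every x₀ ∈ X admits a solution of ẋ(t) = f(x_t) on [0,∞) (write φ(t,x₀) := x_t) and that there exists σ ∈ KL with ‖φ(t,x₀)‖_X ≤ σ(‖x₀‖_X, t) for all t ≥ 0 and x₀ ∈ X. Then for every T, R > 0 there exists M > 0 (one may take M = 1 + (1 + r^{1/p}) max(1, L(σ(R,0)) exp(L(σ(R,0)) T))) such that ‖φ(t,x₀) − φ(t,y₀)‖_X ≤ M ‖x₀ − y₀‖_X for all t ∈ [0,T] and all x₀, y₀ ∈ X with ‖x₀‖_X ≤ R and ‖y₀‖_X ≤ R. -/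

import Mathlib

open Set MeasureTheory Filter Topology
open scoped ENNReal NNReal

noncomputable section

abbrev Vec (n : ℕ) := EuclideanSpace ℝ (Fin n)

variable {n : ℕ}

/-- The segment `x_t` of a history `x : ℝ → ℝⁿ`, i.e. `x_t(s) = x(t+s)`
(only its values on `[-r,0]` are relevant). -/
def seg (r : ℝ) (x : ℝ → Vec n) (t : ℝ) : ℝ → Vec n := fun s => x (t + s)

/-- Sup norm over `[-r,0]`. -/
def supN (r : ℝ) (g : ℝ → Vec n) : ℝ := sSup ((fun s => ‖g s‖) '' Icc (-r) 0)

/-- Membership in `C⁰ = C([-r,0];ℝⁿ)`. -/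
def MemC0 (r : ℝ) (g : ℝ → Vec n) : Prop := ContinuousOn g (Icc (-r) 0)

/-- `f` vanishes at `0`, depends only on the values of its argument on `[-r,0]`,
and is Lipschitz on bounded subsets of `C⁰` with a nondecreasing (nonnegative)
modulus `L`. -/
def GoodRHS (r : ℝ) (f : (ℝ → Vec n) → Vec n) (L : ℝ → ℝ) : Prop :=
  f 0 = 0 ∧
  (∀ x y : ℝ → Vec n, EqOn x y (Icc (-r) 0) → f x = f y) ∧
  Monotone L ∧ (∀ s : ℝ, 0 ≤ L s) ∧
  ∀ R : ℝ, ∀ x y : ℝ → Vec n, MemC0 r x → MemC0 r y → supN r x ≤ R → supN r y ≤ R →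
    ‖f x - f y‖ ≤ L R * supN r (x - y)

/-- `x : ℝ → ℝⁿ` is a solution on `[-r, b)` (with `b ∈ (0,∞]` an extended
nonnegative real) of the delay system `ẋ(t) = f(x_t)` with initial condition `x0`:
it is continuous on `[-r,b)`, coincides with `x0` on `[-r,0]`, and satisfies the
integral equation `x(t) = x(0) + ∫₀ᵗ f(x_s) ds` on `[0,b)`. -/
def IsSol (r : ℝ) (f : (ℝ → Vec n) → Vec n) (x0 x : ℝ → Vec n) (b : ℝ≥0∞) : Prop :=
  ContinuousOn x {t : ℝ | -r ≤ t ∧ ENNReal.ofReal t < b} ∧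
  EqOn x x0 (Icc (-r) 0) ∧
  ∀ t : ℝ, 0 ≤ t → ENNReal.ofReal t < b → x t = x 0 + ∫ s in (0:ℝ)..t, f (seg r x s)

/-- Class `KL` functions `σ : [0,∞)×[0,∞) → [0,∞)`. -/
def ClassKL (σ : ℝ → ℝ → ℝ) : Prop :=
  (∀ s t : ℝ, 0 ≤ s → 0 ≤ t → 0 ≤ σ s t) ∧
  (∀ t : ℝ, 0 ≤ t →
    ContinuousOn (fun s => σ s t) (Ici 0) ∧ StrictMonoOn (fun s => σ s t) (Ici 0) ∧
      σ 0 t = 0) ∧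
  (∀ s : ℝ, 0 ≤ s →
    AntitoneOn (fun t => σ s t) (Ici 0) ∧ Tendsto (fun t => σ s t) atTop (nhds 0))

/-- Class `K∞` functions `a : [0,∞) → [0,∞)`. -/
def ClassKInf (a : ℝ → ℝ) : Prop :=
  (∀ s : ℝ, 0 ≤ s → 0 ≤ a s) ∧ ContinuousOn a (Ici 0) ∧ StrictMonoOn a (Ici 0) ∧
  a 0 = 0 ∧ Tendsto a atTop atTop

/-- The set of Hölder difference quotients `‖g t - g s‖ / |t-s|^α` over a set `S`. -/
def hRatios (α : ℝ) (S : Set ℝ) (g : ℝ → Vec n) : Set ℝ :=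
  {c | ∃ t ∈ S, ∃ s ∈ S, t ≠ s ∧ c = ‖g t - g s‖ / |t - s| ^ α}

/-- Membership in the Hölder space `C^{0,α}([-r,0])`. -/
def MemHol (r α : ℝ) (g : ℝ → Vec n) : Prop :=
  MemC0 r g ∧ BddAbove (hRatios α (Icc (-r) 0) g)

/-- The Hölder norm `max(‖g‖_∞, [g]_α)`. -/
def holderNorm (r α : ℝ) (g : ℝ → Vec n) : ℝ :=
  max (supN r g) (sSup (hRatios α (Icc (-r) 0) g))

/-- Membership in the Sobolev space `W^{1,p}([-r,0])`: `g` is absolutely continuous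
on `[-r,0]` (i.e. the integral of an integrable function `d`, which is then its a.e.
derivative) with `d ∈ L^p((-r,0))`. -/
def MemW (r : ℝ) (p : ℝ≥0∞) (g : ℝ → Vec n) : Prop :=
  ∃ d : ℝ → Vec n, IntegrableOn d (Icc (-r) 0) ∧
    eLpNorm d p (volume.restrict (Ioo (-r) 0)) < ⊤ ∧
    ∀ t ∈ Icc (-r) 0, g t = g (-r) + ∫ s in (-r)..t, d s

/-- The Sobolev norm `‖g‖_∞ + ‖ġ‖_p`; for an absolutely continuous `g` the a.e.
derivative coincides a.e. on `(-r,0)` with `deriv g`. -/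
def sobNorm (r : ℝ) (p : ℝ≥0∞) (g : ℝ → Vec n) : ℝ :=
  supN r g + (eLpNorm (deriv g) p (volume.restrict (Ioo (-r) 0))).toReal

/-- The Hölder exponent `1 - 1/p`, with the convention `1/∞ = 0`. -/
def hexp (p : ℝ≥0∞) : ℝ := 1 - (p.toReal)⁻¹


theorem supN_le' {r : ℝ} {g : ℝ → Vec n} {C : ℝ} (hC : 0 ≤ C)
    (h : ∀ s ∈ Icc (-r) 0, ‖g s‖ ≤ C) : supN r g ≤ C := by
  apply Real.sSup_le _ hC
  rintro _ ⟨s, hs, rfl⟩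
  exact h s hs

theorem le_supN' {r : ℝ} {g : ℝ → Vec n} (hg : MemC0 r g) {s : ℝ} (hs : s ∈ Icc (-r) 0) :
    ‖g s‖ ≤ supN r g := by
  exact le_csSup (isCompact_Icc.image_of_continuousOn hg.norm).bddAbove
    (mem_image_of_mem (fun s => ‖g s‖) hs)

theorem supN_nonneg' (r : ℝ) (g : ℝ → Vec n) : 0 ≤ supN r g := by
  apply Real.sSup_nonneg
  rintro _ ⟨s, hs, rfl⟩
  exact norm_nonneg _

theorem memC0_seg {r : ℝ} {x : ℝ → Vec n} (hx : ContinuousOn x (Ici (-r))) {t : ℝ}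
    (ht : 0 ≤ t) : MemC0 r (seg r x t) := by
  apply hx.comp (by fun_prop)
  intro s hs
  simp only [mem_Icc, mem_Ici] at *
  linarith

theorem cont_rhs {r : ℝ} {f : (ℝ → Vec n) → Vec n} {L : ℝ → ℝ} (hf : GoodRHS r f L)
    {x : ℝ → Vec n} (hx : ContinuousOn x (Ici (-r))) {S : ℝ}
    (hS : ∀ t, 0 ≤ t → supN r (seg r x t) ≤ S) (T : ℝ) :
    ContinuousOn (fun s => f (seg r x s)) (Icc 0 T) := by
  have hu : UniformContinuousOn x (Icc (-r) T) :=
    isCompact_Icc.uniformContinuousOn_of_continuous (hx.mono Icc_subset_Ici_self)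
  obtain ⟨-, -, -, hL0, hLip⟩ := hf
  rw [Metric.continuousOn_iff]
  intro b hb ε hε
  have hK := hL0 S
  rw [Metric.uniformContinuousOn_iff] at hu
  obtain ⟨δ, hδ, h⟩ := hu (ε / (L S + 1)) (by positivity)
  refine ⟨δ, hδ, fun a ha hab => ?_⟩
  rw [dist_eq_norm]
  have h1 := hLip S (seg r x a) (seg r x b) (memC0_seg hx ha.1) (memC0_seg hx hb.1)
    (hS a ha.1) (hS b hb.1)
  have h2 : supN r (seg r x a - seg r x b) ≤ ε / (L S + 1) := by
    apply supN_le' (by positivity)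
    intro s hs
    have := h (a + s) ⟨by linarith [hs.1, ha.1], by linarith [hs.2, ha.2]⟩ (b + s)
      ⟨by linarith [hs.1, hb.1], by linarith [hs.2, hb.2]⟩ (by simpa using hab)
    rw [dist_eq_norm] at this
    exact this.le
  calc _ ≤ _ := h1
    _ ≤ L S * (ε / (L S + 1)) := by gcongr
    _ < ε := by
      rw [mul_div_assoc', div_lt_iff₀ (by positivity)]
      nlinarith

/-- Explicit constant of the sup-norm estimate. -/
def cc (K T : ℝ) : ℝ := 1 + 2 * (1 + K * T) * Real.exp (2 * (K + 1) * T)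

theorem core {r : ℝ} (hr : 0 < r) {f : (ℝ → Vec n) → Vec n} {L : ℝ → ℝ} (hf : GoodRHS r f L)
    {x y : ℝ → Vec n} (hx : ContinuousOn x (Ici (-r))) (hy : ContinuousOn y (Ici (-r))) {S : ℝ}
    (hSx : ∀ t, 0 ≤ t → supN r (seg r x t) ≤ S) (hSy : ∀ t, 0 ≤ t → supN r (seg r y t) ≤ S)
    (hxe : ∀ t, 0 ≤ t → x t = x 0 + ∫ s in (0:ℝ)..t, f (seg r x s))
    (hye : ∀ t, 0 ≤ t → y t = y 0 + ∫ s in (0:ℝ)..t, f (seg r y s))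
    {T : ℝ} (hT : 0 < T) :
    (∀ t ∈ Icc (-r) T, ‖x t - y t‖ ≤ cc (L S) T * supN r (x - y)) ∧
    (∀ a ∈ Icc 0 T, ∀ b ∈ Icc 0 T,
      ‖(x b - y b) - (x a - y a)‖ ≤ L S * (cc (L S) T * supN r (x - y)) * |b - a|) := by
  have cx := cont_rhs hf hx hSx T
  have cy := cont_rhs hf hy hSy T
  have hK := hf.2.2.2.1 S
  have hLip := hf.2.2.2.2 S
  set K := L S with hKdef
  set D := supN r (x - y) with hD
  have hD0 : 0 ≤ D := supN_nonneg' _ _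
  have hw0 : ∀ s ∈ Icc (-r) 0, ‖x s - y s‖ ≤ D := fun s hs =>
    le_supN' (g := x - y) ((hx.mono Icc_subset_Ici_self).sub (hy.mono Icc_subset_Ici_self)) hs
  have ix : ∀ a ∈ Icc 0 T, ∀ b ∈ Icc 0 T,
      IntervalIntegrable (fun s => f (seg r x s)) volume a b := fun a ha b hb =>
    (cx.mono (uIcc_subset_Icc ha hb)).intervalIntegrable
  have iy : ∀ a ∈ Icc 0 T, ∀ b ∈ Icc 0 T,
      IntervalIntegrable (fun s => f (seg r y s)) volume a b := fun a ha b hb =>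
    (cy.mono (uIcc_subset_Icc ha hb)).intervalIntegrable
  have h0T : (0:ℝ) ∈ Icc 0 T := ⟨le_rfl, hT.le⟩
  have hdiff : ∀ a ∈ Icc 0 T, ∀ b ∈ Icc 0 T, (x b - y b) - (x a - y a) =
      ∫ s in a..b, (f (seg r x s) - f (seg r y s)) := by
    intro a ha b hb
    rw [intervalIntegral.integral_sub (ix a ha b hb) (iy a ha b hb),
      ← intervalIntegral.integral_interval_sub_left (ix 0 h0T b hb) (ix 0 h0T a ha),
      ← intervalIntegral.integral_interval_sub_left (iy 0 h0T b hb) (iy 0 h0T a ha),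
      hxe a ha.1, hxe b hb.1, hye a ha.1, hye b hb.1]
    abel
  have hfl : ∀ t ∈ Icc 0 T, ∀ C, 0 ≤ C → (∀ s ∈ Icc (-r) t, ‖x s - y s‖ ≤ C) →
      ‖f (seg r x t) - f (seg r y t)‖ ≤ K * C := by
    intro t ht C hC h
    refine (hLip _ _ (memC0_seg hx ht.1) (memC0_seg hy ht.1) (hSx t ht.1) (hSy t ht.1)).trans ?_
    gcongr
    apply supN_le' hC
    intro s hs
    exact h (t + s) ⟨by linarith [hs.1, ht.1], by linarith [hs.2]⟩
  set l := 2 * (K + 1) with hl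
  have hl0 : 0 < l := by positivity
  -- maximum of the weighted difference
  obtain ⟨τ, hτ, hmax⟩ := isCompact_Icc.exists_isMaxOn (s := Icc (0:ℝ) T)
    (f := fun t => Real.exp (-(l * t)) * ‖x t - y t‖) ⟨0, h0T⟩ (by
      have h1 : Icc (0:ℝ) T ⊆ Ici (-r) := fun s hs => by
        simp only [mem_Ici]; linarith [hs.1]
      exact (by fun_prop : Continuous fun t => Real.exp (-(l * t))).continuousOn.mul
        ((hx.mono h1).sub (hy.mono h1)).norm)
  set m := Real.exp (-(l * τ)) * ‖x τ - y τ‖ with hm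
  have hm0 : 0 ≤ m := by positivity
  have hwm : ∀ t ∈ Icc 0 T, ‖x t - y t‖ ≤ m * Real.exp (l * t) := by
    intro t ht
    have h1 : Real.exp (-(l * t)) * ‖x t - y t‖ ≤ m := hmax ht
    rw [Real.exp_neg, inv_mul_le_iff₀ (Real.exp_pos _)] at h1
    linarith
  have hFb : ∀ t ∈ Icc 0 T, ‖f (seg r x t) - f (seg r y t)‖ ≤ K * (D + m * Real.exp (l * t)) := by
    intro t ht
    apply hfl t ht _ (by positivity)
    intro s hs
    rcases le_total s 0 with h | h
    · have := hw0 s ⟨hs.1, h⟩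
      have : 0 ≤ m * Real.exp (l * t) := by positivity
      linarith
    · have := hwm s ⟨h, hs.2.trans ht.2⟩
      have : m * Real.exp (l * s) ≤ m * Real.exp (l * t) := by
        gcongr
        exact hs.2
      linarith
  have hint : ‖(x τ - y τ) - (x 0 - y 0)‖ ≤ ∫ s in (0:ℝ)..τ, K * (D + m * Real.exp (l * s)) := by
    rw [hdiff 0 h0T τ hτ]
    apply intervalIntegral.norm_integral_le_of_norm_le hτ.1
    · refine Eventually.of_forall fun s hs => hFb s ⟨hs.1.le, hs.2.trans hτ.2⟩
    · apply Continuous.intervalIntegrable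
      fun_prop
  have hval : ∫ s in (0:ℝ)..τ, K * (D + m * Real.exp (l * s)) =
      K * (D * τ + m * ((Real.exp (l * τ) - 1) / l)) := by
    rw [intervalIntegral.integral_const_mul, intervalIntegral.integral_add (by simp)
      (by apply Continuous.intervalIntegrable; fun_prop), intervalIntegral.integral_const_mul,
      intervalIntegral.integral_comp_mul_left (fun s => Real.exp s) hl0.ne', integral_exp]
    simp
    left
    ring
  rw [hval] at hint
  have hE1 : (1:ℝ) ≤ Real.exp (l * τ) := Real.one_le_exp (mul_nonneg hl0.le hτ.1)
  have hwτ : ‖x τ - y τ‖ ≤ D * (1 + K * T) + m * Real.exp (l * τ) / 2 := by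
    have h1 : ‖x τ - y τ‖ ≤ ‖(x τ - y τ) - (x 0 - y 0)‖ + ‖x 0 - y 0‖ := norm_le_norm_sub_add _ _
    have h2 := hw0 0 ⟨by linarith, le_rfl⟩
    have h3 : K * (D * τ) ≤ K * (D * T) := by gcongr; exact hτ.2
    have h4 : K * (m * ((Real.exp (l * τ) - 1) / l)) ≤ m * Real.exp (l * τ) / 2 := by
      have : K * (m * ((Real.exp (l * τ) - 1) / l)) = m * (Real.exp (l * τ) - 1) * (K / l) := by
        ring
      rw [this]
      have h5 : K / l ≤ 1 / 2 := by
        rw [div_le_iff₀ hl0, hl]; linarith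
      have h6 : 0 ≤ m * (Real.exp (l * τ) - 1) := mul_nonneg hm0 (by linarith)
      have := mul_le_mul_of_nonneg_left h5 h6
      linarith
    nlinarith
  have hmE : ‖x τ - y τ‖ = m * Real.exp (l * τ) := by
    rw [hm, mul_right_comm, ← Real.exp_add]; simp
  have hmb : m ≤ 2 * D * (1 + K * T) := by
    have : m ≤ m * Real.exp (l * τ) := le_mul_of_one_le_right hm0 hE1
    linarith
  have hcc : 0 ≤ cc K T := by unfold cc; positivity
  have hsup : ∀ t ∈ Icc (-r) T, ‖x t - y t‖ ≤ cc K T * D := by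
    intro t ht
    have hp : 0 ≤ 2 * (1 + K * T) * Real.exp (l * T) * D := by positivity
    have he : cc K T * D = D + 2 * (1 + K * T) * Real.exp (l * T) * D := by
      unfold cc; ring
    rw [he]
    rcases le_total t 0 with h | h
    · have := hw0 t ⟨ht.1, h⟩
      linarith
    · have h1 := hwm t ⟨h, ht.2⟩
      have h2 : m * Real.exp (l * t) ≤ 2 * D * (1 + K * T) * Real.exp (l * T) := by
        gcongr
        exact ht.2
      linarith
  refine ⟨hsup, fun a ha b hb => ?_⟩
  rw [hdiff a ha b hb]
  apply intervalIntegral.norm_integral_le_of_norm_le_const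
  intro s hs
  have hs' : s ∈ Icc 0 T := uIcc_subset_Icc ha hb (uIoc_subset_uIcc hs)
  apply hfl s hs' _ (by positivity)
  intro u hu
  exact hsup u ⟨hu.1, hu.2.trans hs'.2⟩

theorem hol_est {r : ℝ} (hr : 0 < r) {α : ℝ} (hα0 : 0 < α) (hα1 : α ≤ 1) {w : ℝ → Vec n}
    {T B : ℝ} (hB : 0 ≤ B)
    (hbd : BddAbove (hRatios α (Icc (-r) 0) w))
    (hlip : ∀ a ∈ Icc 0 T, ∀ b ∈ Icc 0 T, ‖w b - w a‖ ≤ B * |b - a|)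
    {t : ℝ} (ht : t ∈ Icc 0 T) :
    sSup (hRatios α (Icc (-r) 0) (seg r w t)) ≤
      B * r ^ (1 - α) + sSup (hRatios α (Icc (-r) 0) w) := by
  set H := sSup (hRatios α (Icc (-r) 0) w) with hH
  have hH0 : 0 ≤ H := by
    apply Real.sSup_nonneg
    rintro _ ⟨a, _, b, _, _, rfl⟩
    positivity
  have h1 : ∀ a ∈ Icc (-r) 0, ∀ b ∈ Icc (-r) 0, ‖w b - w a‖ ≤ H * |b - a| ^ α := by
    intro a ha b hb
    by_cases hab : b = a
    · subst hab
      simp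
      positivity
    · have h2 : ‖w b - w a‖ / |b - a| ^ α ≤ H := le_csSup hbd ⟨b, hb, a, ha, hab, rfl⟩
      have h3 : 0 < |b - a| := abs_pos.2 (sub_ne_zero.2 hab)
      rwa [div_le_iff₀ (by positivity)] at h2
  have h2 : ∀ a ∈ Icc 0 T, ∀ b ∈ Icc 0 T, |b - a| ≤ r →
      ‖w b - w a‖ ≤ B * r ^ (1 - α) * |b - a| ^ α := by
    intro a ha b hb hab
    refine (hlip a ha b hb).trans ?_
    rw [mul_assoc]
    gcongr
    by_cases h0 : |b - a| = 0
    · rw [h0]; positivity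
    · have h3 : 0 < |b - a| := lt_of_le_of_ne (abs_nonneg _) (Ne.symm h0)
      calc |b - a| = |b - a| ^ (1 - α) * |b - a| ^ α := by
            rw [← Real.rpow_add h3]; simp
        _ ≤ _ := by
            gcongr
  have key : ∀ a b, -r ≤ a → a ≤ b → b ≤ T → b - a ≤ r →
      ‖w b - w a‖ ≤ (B * r ^ (1 - α) + H) * (b - a) ^ α := by
    intro a b ha hab hb hbr
    have hab0 : |b - a| = b - a := abs_of_nonneg (by linarith)
    have hP : 0 ≤ B * r ^ (1 - α) := by positivity
    have hQ : 0 ≤ (b - a) ^ α := Real.rpow_nonneg (by linarith) _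
    rw [add_mul]
    have hP' := mul_nonneg hP hQ
    have hH' := mul_nonneg hH0 hQ
    rcases le_total b 0 with hb0 | hb0
    · have := h1 a ⟨ha, hab.trans hb0⟩ b ⟨ha.trans hab, hb0⟩
      rw [hab0] at this
      linarith
    · rcases le_total a 0 with ha0 | ha0
      · have e1 := h1 a ⟨ha, ha0⟩ 0 ⟨by linarith, le_rfl⟩
        have e2 := h2 0 ⟨le_rfl, hb0.trans hb⟩ b ⟨hb0, hb⟩ (by
          rw [abs_of_nonneg] <;> linarith)
        have e3 : |0 - a| ^ α ≤ (b - a) ^ α := by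
          apply Real.rpow_le_rpow (abs_nonneg _) _ hα0.le
          rw [abs_of_nonneg] <;> linarith
        have e4 : |b - 0| ^ α ≤ (b - a) ^ α := by
          apply Real.rpow_le_rpow (abs_nonneg _) _ hα0.le
          rw [abs_of_nonneg] <;> linarith
        have e5 := norm_sub_le_norm_sub_add_norm_sub (w b) (w 0) (w a)
        have e6 := mul_le_mul_of_nonneg_left e3 hH0
        have e7 := mul_le_mul_of_nonneg_left e4 hP
        linarith
      · have := h2 a ⟨ha0, hab.trans hb⟩ b ⟨hb0, hb⟩ (by rw [hab0]; exact hbr)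
        rw [hab0] at this
        linarith
  have hC0 : 0 ≤ B * r ^ (1 - α) + H := by positivity
  apply Real.sSup_le _ hC0
  rintro _ ⟨a, ha, b, hb, hab, rfl⟩
  have h3 : 0 < |a - b| := abs_pos.2 (sub_ne_zero.2 hab)
  rw [div_le_iff₀ (by positivity)]
  simp only [seg]
  obtain ⟨ht0, htT⟩ := ht
  obtain ⟨ha1, ha2⟩ := ha
  obtain ⟨hb1, hb2⟩ := hb
  rcases le_total a b with h | h
  · have := key (t + a) (t + b) (by linarith) (by linarith) (by linarith) (by linarith)
    rw [norm_sub_rev, abs_sub_comm, abs_of_nonneg (by linarith : 0 ≤ b - a)]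
    simpa using this
  · have := key (t + b) (t + a) (by linarith) (by linarith) (by linarith) (by linarith)
    rw [abs_of_nonneg (by linarith : 0 ≤ a - b)]
    simpa using this

theorem memW_deriv {r : ℝ} (hr : 0 < r) {p : ℝ≥0∞} {g : ℝ → Vec n} (hg : MemW r p g) :
    ∃ d : ℝ → Vec n, MemLp d p (volume.restrict (Ioo (-r) 0)) ∧
      ∀ᵐ s ∂(volume.restrict (Ioo (-r) 0)), HasDerivAt g (d s) s := by
  obtain ⟨d, hi, hlp, he⟩ := hg
  refine ⟨d, ⟨(hi.mono_set Ioo_subset_Icc_self).aestronglyMeasurable, hlp⟩, ?_⟩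
  have hii : IntervalIntegrable d volume (-r) 0 := by
    rw [intervalIntegrable_iff_integrableOn_Icc_of_le (by linarith)]
    exact hi
  rw [ae_restrict_iff' measurableSet_Ioo]
  filter_upwards [hii.ae_hasDerivAt_integral] with s hs hs'
  rw [uIcc_of_le (by linarith)] at hs
  have h1 := (hs (Ioo_subset_Icc_self hs') (-r) ⟨le_rfl, by linarith⟩).const_add (g (-r))
  apply h1.congr_of_eventuallyEq
  filter_upwards [Ioo_mem_nhds hs'.1 hs'.2] with u hu
  exact he u (Ioo_subset_Icc_self hu)

theorem memW_sub {r : ℝ} (hr : 0 < r) {p : ℝ≥0∞} {g h : ℝ → Vec n} (hg : MemW r p g)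
    (hh : MemW r p h) : eLpNorm (deriv (g - h)) p (volume.restrict (Ioo (-r) 0)) < ⊤ := by
  obtain ⟨d, hd, hd'⟩ := memW_deriv hr hg
  obtain ⟨e, he, he'⟩ := memW_deriv hr hh
  have : deriv (g - h) =ᵐ[volume.restrict (Ioo (-r) 0)] d - e := by
    filter_upwards [hd', he'] with s h1 h2
    exact (h1.sub h2).deriv
  rw [eLpNorm_congr_ae this]
  exact (hd.sub he).2

theorem sob_est {r : ℝ} (hr : 0 < r) {p : ℝ≥0∞} (hp : 1 < p) {w : ℝ → Vec n}
    {T B : ℝ} (hB : 0 ≤ B)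
    (hbd : eLpNorm (deriv w) p (volume.restrict (Ioo (-r) 0)) < ⊤)
    (hlip : ∀ a ∈ Icc 0 T, ∀ b ∈ Icc 0 T, ‖w b - w a‖ ≤ B * |b - a|)
    {t : ℝ} (ht : t ∈ Icc 0 T) :
    (eLpNorm (deriv (seg r w t)) p (volume.restrict (Ioo (-r) 0))).toReal ≤
      r ^ (p.toReal⁻¹) * B + (eLpNorm (deriv w) p (volume.restrict (Ioo (-r) 0))).toReal := by
  set G : ℝ → Vec n := (Ioo (-r) 0).indicator (deriv w) with hG
  have hmeas : StronglyMeasurable G := (stronglyMeasurable_deriv w).indicator measurableSet_Ioo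
  have hder : ∀ s, deriv (seg r w t) s = deriv w (t + s) := fun s =>
    deriv_comp_const_add w t s
  have h1 : ∀ᵐ s ∂(volume.restrict (Ioo (-r) 0)), ‖deriv (seg r w t) s‖ ≤
      ((fun _ => B) + fun s => ‖G (t + s)‖ : ℝ → ℝ) s := by
    rw [ae_restrict_iff' measurableSet_Ioo]
    have hne : ∀ᵐ s : ℝ, s ≠ -t := by simp [ae_iff, measure_singleton]
    filter_upwards [hne] with s hs hs'
    rw [hder]
    simp only [Pi.add_apply]
    obtain ⟨hs1, hs2⟩ := hs'
    obtain ⟨ht1, ht2⟩ := ht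
    rcases lt_trichotomy (t + s) 0 with h | h | h
    · have hmem : t + s ∈ Ioo (-r) 0 := ⟨by linarith, h⟩
      have : G (t + s) = deriv w (t + s) := indicator_of_mem hmem _
      rw [this]
      linarith
    · exact absurd (by linarith) hs
    · have : ‖deriv w (t + s)‖ ≤ B := by
        apply norm_deriv_le_of_lip' hB
        filter_upwards [Ioo_mem_nhds h (by linarith : t + s < T)] with u hu
        exact hlip _ ⟨h.le, by linarith⟩ _ ⟨hu.1.le, hu.2.le⟩
      have := norm_nonneg (G (t + s))
      linarith
  have h2 := eLpNorm_mono_ae_real (p := p) h1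
  have h3 : eLpNorm (fun s => ‖G (t + s)‖) p (volume.restrict (Ioo (-r) 0)) ≤
      eLpNorm (deriv w) p (volume.restrict (Ioo (-r) 0)) := by
    rw [eLpNorm_norm (fun s => G (t + s))]
    have hmp : MeasurePreserving (fun s : ℝ => t + s) volume volume :=
      measurePreserving_add_left volume t
    have hcomp := eLpNorm_comp_measurePreserving (p := p) hmeas.aestronglyMeasurable hmp
    calc _ ≤ eLpNorm (fun s => G (t + s)) p volume :=
          eLpNorm_mono_measure _ Measure.restrict_le_self
      _ = eLpNorm G p volume := hcomp
      _ = _ := eLpNorm_indicator_eq_eLpNorm_restrict measurableSet_Ioo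
  have h4 : eLpNorm (fun _ : ℝ => B) p (volume.restrict (Ioo (-r) 0)) ≤
      ENNReal.ofReal (r ^ (p.toReal⁻¹) * B) := by
    refine (eLpNorm_le_of_ae_bound (C := B) (Eventually.of_forall fun _ => ?_)).trans ?_
    · rw [Real.norm_of_nonneg hB]
    · rw [ENNReal.ofReal_mul (by positivity), ← ENNReal.ofReal_rpow_of_pos hr]
      simp
  have h5 := h2.trans ((eLpNorm_add_le aestronglyMeasurable_const
    ((hmeas.comp_measurable (measurable_const_add t)).norm.aestronglyMeasurable) hp.le).trans
    (add_le_add h4 h3))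
  have h6 := ENNReal.toReal_mono (ENNReal.add_ne_top.2 ⟨ENNReal.ofReal_ne_top, hbd.ne⟩) h5
  rwa [ENNReal.toReal_add ENNReal.ofReal_ne_top hbd.ne,
    ENNReal.toReal_ofReal (by positivity)] at h6

theorem supN_le_NormX {r : ℝ} {p : ℝ≥0∞} {MemX : (ℝ → Vec n) → Prop} {NormX : (ℝ → Vec n) → ℝ}
    (hX : (MemX = MemW r p ∧ NormX = sobNorm r p) ∨
          (MemX = MemHol r (hexp p) ∧ NormX = holderNorm r (hexp p))) (g : ℝ → Vec n) :
    supN r g ≤ NormX g := by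
  rcases hX with ⟨-, rfl⟩ | ⟨-, rfl⟩
  · exact le_add_of_nonneg_right ENNReal.toReal_nonneg
  · exact le_max_left _ _

theorem hRatios_congr {α : ℝ} {S : Set ℝ} {g h : ℝ → Vec n} (hgh : EqOn g h S) :
    hRatios α S g = hRatios α S h := by
  ext c
  constructor
  · rintro ⟨t, ht, s, hs, hts, rfl⟩
    exact ⟨t, ht, s, hs, hts, by rw [hgh ht, hgh hs]⟩
  · rintro ⟨t, ht, s, hs, hts, rfl⟩
    exact ⟨t, ht, s, hs, hts, by rw [hgh ht, hgh hs]⟩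

theorem hRatios_sub {α : ℝ} {S : Set ℝ} {g h : ℝ → Vec n} (hg : BddAbove (hRatios α S g))
    (hh : BddAbove (hRatios α S h)) : BddAbove (hRatios α S (g - h)) := by
  obtain ⟨A, hA⟩ := hg
  obtain ⟨B, hB⟩ := hh
  refine ⟨A + B, ?_⟩
  rintro _ ⟨t, ht, s, hs, hts, rfl⟩
  have h1 := hA ⟨t, ht, s, hs, hts, rfl⟩
  have h2 := hB ⟨t, ht, s, hs, hts, rfl⟩
  refine le_trans ?_ (add_le_add h1 h2)
  rw [← add_div]
  gcongr
  have : (g - h) t - (g - h) s = (g t - g s) - (h t - h s) := by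
    simp only [Pi.sub_apply]; abel
  rw [this]
  exact norm_sub_le _ _

theorem supN_congr' {r : ℝ} {g h : ℝ → Vec n} (hgh : EqOn g h (Icc (-r) 0)) :
    supN r g = supN r h := by
  unfold supN
  congr 1
  apply image_congr
  intro s hs
  simp only [hgh hs]

/-- **Property (H).** Under UGAS in `X = W^{1,p}` or
`X = C^{0,1-1/p}` (`p ∈ (1,∞]`), solutions depend Lipschitz-continuously (in the
`X`-norm) on the initial state, uniformly on bounded sets of initial states and
finite time horizons. -/
theorem stmt17 (n : ℕ) (hn : 1 ≤ n) (r : ℝ) (hr : 0 < r)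
    (f : (ℝ → Vec n) → Vec n) (L : ℝ → ℝ) (hf : GoodRHS r f L)
    (p : ℝ≥0∞) (hp : 1 < p)
    (MemX : (ℝ → Vec n) → Prop) (NormX : (ℝ → Vec n) → ℝ)
    (hX : (MemX = MemW r p ∧ NormX = sobNorm r p) ∨
          (MemX = MemHol r (hexp p) ∧ NormX = holderNorm r (hexp p)))
    (hFC : ∀ x0 : ℝ → Vec n, MemX x0 → ∃ x : ℝ → Vec n, IsSol r f x0 x ⊤)
    (σ : ℝ → ℝ → ℝ) (hσ : ClassKL σ)
    (hUG : ∀ x0 x : ℝ → Vec n, MemX x0 → IsSol r f x0 x ⊤ →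
      ∀ t : ℝ, 0 ≤ t → NormX (seg r x t) ≤ σ (NormX x0) t) :
    ∀ T R : ℝ, 0 < T → 0 < R → ∃ M : ℝ, 0 < M ∧
      ∀ x0 y0 x y : ℝ → Vec n, MemX x0 → MemX y0 →
        IsSol r f x0 x ⊤ → IsSol r f y0 y ⊤ → NormX x0 ≤ R → NormX y0 ≤ R →
        ∀ t ∈ Icc (0:ℝ) T, NormX (seg r x t - seg r y t) ≤ M * NormX (x0 - y0) := by
  intro T R hT hR
  set S := σ R 0 with hS
  have hK : 0 ≤ L S := hf.2.2.2.1 S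
  set K := L S with hKd
  have hcc : 0 ≤ cc K T := by unfold cc; positivity
  set P := r ^ (p.toReal⁻¹) with hP
  have hP0 : 0 ≤ P := by positivity
  refine ⟨cc K T + P * (K * cc K T) + 1, by positivity, ?_⟩
  intro x0 y0 x y mx my sx sy nx ny t ht
  have hset : {t : ℝ | -r ≤ t ∧ ENNReal.ofReal t < ⊤} = Ici (-r) := by
    ext; simp
  have hb : ∀ z0 z : ℝ → Vec n, MemX z0 → IsSol r f z0 z ⊤ → NormX z0 ≤ R →
      ∀ t, 0 ≤ t → supN r (seg r z t) ≤ S := by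
    intro z0 z mz sz nz t ht
    have h0 : 0 ≤ NormX z0 := (supN_nonneg' r z0).trans (supN_le_NormX hX z0)
    calc _ ≤ NormX (seg r z t) := supN_le_NormX hX _
      _ ≤ σ (NormX z0) t := hUG z0 z mz sz t ht
      _ ≤ σ (NormX z0) 0 := (hσ.2.2 _ h0).1 (mem_Ici.2 le_rfl) ht ht
      _ ≤ σ R 0 := (hσ.2.1 0 le_rfl).2.1.monotoneOn h0 hR.le nz
  have bx := hb x0 x mx sx nx
  have bY := hb y0 y my sy ny
  obtain ⟨cx, ex, ix⟩ := sx
  obtain ⟨cy, ey, iy⟩ := sy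
  rw [hset] at cx cy
  obtain ⟨hsup, hlip⟩ := core hr hf cx cy bx bY (fun t ht => ix t ht (by simp))
    (fun t ht => iy t ht (by simp)) hT
  have hE : EqOn (x - y) (x0 - y0) (Icc (-r) 0) := fun s hs => by
    simp only [Pi.sub_apply, ex hs, ey hs]
  rw [supN_congr' hE] at hsup hlip
  rw [← hKd] at hsup hlip
  set D := supN r (x0 - y0) with hD
  have hD0 : 0 ≤ D := supN_nonneg' _ _
  have hsn : supN r (seg r x t - seg r y t) ≤ cc K T * D := by
    apply supN_le' (by positivity)
    intro s hs
    exact hsup (t + s) ⟨by linarith [ht.1, hs.1], by linarith [ht.2, hs.2]⟩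
  have hseg : seg r x t - seg r y t = seg r (x - y) t := rfl
  have hB : 0 ≤ K * (cc K T * D) := by positivity
  rcases hX with ⟨rfl, rfl⟩ | ⟨rfl, rfl⟩
  · have hde : ∀ᵐ s ∂(volume.restrict (Ioo (-r) 0)), deriv (x - y) s = deriv (x0 - y0) s := by
      rw [ae_restrict_iff' measurableSet_Ioo]
      refine Eventually.of_forall fun s hs => ?_
      apply EventuallyEq.deriv_eq
      filter_upwards [Ioo_mem_nhds hs.1 hs.2] with u hu using hE (Ioo_subset_Icc_self hu)
    have hlt := memW_sub hr mx my
    rw [← eLpNorm_congr_ae hde] at hlt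
    have h1 := sob_est hr hp hB hlt hlip ht
    rw [eLpNorm_congr_ae hde] at h1
    unfold sobNorm
    rw [← hseg] at h1
    rw [← hD]
    rw [← hP] at h1
    set Q := (eLpNorm (deriv (x0 - y0)) p (volume.restrict (Ioo (-r) 0))).toReal with hQ
    have hQ0 : 0 ≤ Q := ENNReal.toReal_nonneg
    have hR1 : 0 ≤ (cc K T + P * (K * cc K T)) * Q := by positivity
    linarith
  · have hα : 1 - hexp p = p.toReal⁻¹ := by unfold hexp; ring
    have hp1 : p.toReal⁻¹ < 1 := by
      by_cases hpt : p = ⊤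
      · simp [hpt]
      · apply inv_lt_one_of_one_lt₀
        rw [← ENNReal.toReal_one]
        exact (ENNReal.toReal_lt_toReal ENNReal.one_ne_top hpt).2 hp
    have hp0 : 0 ≤ p.toReal⁻¹ := by positivity
    have hbd := hRatios_sub mx.2 my.2
    have hcg := hRatios_congr (α := hexp p) hE
    rw [← hcg] at hbd
    have h1 := hol_est hr (by linarith) (by linarith) hB hbd hlip ht
    rw [hcg, hα, ← hP, ← hseg] at h1
    unfold holderNorm
    rw [← hD]
    set Q := sSup (hRatios (hexp p) (Icc (-r) 0) (x0 - y0)) with hQ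
    have hm1 : D ≤ max D Q := le_max_left _ _
    have hm2 : Q ≤ max D Q := le_max_right _ _
    have hm0 : 0 ≤ max D Q := hD0.trans hm1
    have e1 : cc K T * D ≤ cc K T * max D Q := by gcongr
    have e2 : P * (K * cc K T) * D ≤ P * (K * cc K T) * max D Q := by gcongr
    have e3 : 0 ≤ P * (K * cc K T) * max D Q := by positivity
    have e4 : 0 ≤ cc K T * max D Q := by positivity
    apply max_le <;> linarith
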